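/- arXiv:1411.3142 — 2 statements merged into one kernel-verified Lean document; each statement's English description precedes it below -/
import Mathlib

section
/- Let N ≥ 1 and let p, q ∈ ℂ with p + q = 1 and q ≠ 0, and set τ = p/q. Let σ be a permutation of {1,…,N} and let z₁,…,z_N ∈ ℂ satisfy q z_j − p z_i ≠ 0 for all i ≠ j. Then ∏_{(α,β)∈In(σ)} S(z_α,z_β) = sgn(σ) · ∏_{1≤i<j≤N} (q z_{σ(j)} − p z_{σ(i)})/(q z_j − p z_i), where S(z_α,z_β) = −(τ z_α − z_β)/(τ z_β − z_α). -/
/-- The ratio of scattering amplitudes `S(z_α, z_β) = −(τ z_α − z_β)/(τ z_β − z_α)`. -/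
noncomputable def Sfac (τ : ℂ) (zα zβ : ℂ) : ℂ := -((τ * zα - zβ) / (τ * zβ - zα))

/-- A product over pairs `i < j` of an antisymmetric function picks up the sign of a permutation
of the indices. -/
theorem prod_lt_comp_perm_eq_sign_mul_prod {n : ℕ} {R : Type*} [CommRing R]
    (σ : Equiv.Perm (Fin n)) {f : Fin n → Fin n → R} (hf : ∀ i j, f i j = -f j i) :
    ∏ pr ∈ Finset.univ.filter (fun pr : Fin n × Fin n => pr.1 < pr.2), f (σ pr.1) (σ pr.2)
      = ((Equiv.Perm.sign σ : ℤ) : R) *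
        ∏ pr ∈ Finset.univ.filter (fun pr : Fin n × Fin n => pr.1 < pr.2), f pr.1 pr.2 := by
  have key (g : Fin n → Fin n → R) :
      ∏ pr ∈ Finset.univ.filter (fun pr : Fin n × Fin n => pr.1 < pr.2), g pr.1 pr.2
        = ∏ i, ∏ j ∈ Finset.Ioi i, g i j :=
    Finset.prod_finset_product' _ _ _ (by simp)
  rw [key f, key fun i j => f (σ i) (σ j)]
  exact σ.prod_Ioi_comp_eq_sign_mul_prod hf

/-- Clearing the factor `q` in the scattering amplitude. -/
theorem Sfac_div {p q : ℂ} (hq : q ≠ 0) (a b : ℂ) :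
    Sfac (p / q) a b = -((q * b - p * a) / (q * a - p * b)) := by
  have h (x y : ℂ) : p / q * x - y = -(q * y - p * x) / q := by
    field_simp
    ring
  rw [Sfac, h, h, div_div_div_cancel_right₀ hq, neg_div_neg_eq]

/-- Rewriting of the Bethe-ansatz amplitude: with `τ = p/q`,
`∏_{(α,β) ∈ In(σ)} S(z_α, z_β) = sgn(σ) ∏_{i<j} (q z_{σ(j)} − p z_{σ(i)})/(q z_j − p z_i)`,
the product on the left being over inversions `(σ(i), σ(j))` with `i < j`, `σ(i) > σ(j)`. -/
theorem amplitude_rewrite (N : ℕ) (hN : 1 ≤ N) (p q : ℂ)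
    (hpq : p + q = 1) (hq : q ≠ 0)
    (σ : Equiv.Perm (Fin N)) (z : Fin N → ℂ)
    (hden : ∀ i j : Fin N, i ≠ j → q * z j - p * z i ≠ 0) :
    (∏ pr ∈ Finset.univ.filter (fun pr : Fin N × Fin N => pr.1 < pr.2 ∧ σ pr.2 < σ pr.1),
      Sfac (p / q) (z (σ pr.1)) (z (σ pr.2)))
    = ((Equiv.Perm.sign σ : ℤ) : ℂ) *
      ∏ pr ∈ Finset.univ.filter (fun pr : Fin N × Fin N => pr.1 < pr.2),
        ((q * z (σ pr.2) - p * z (σ pr.1)) / (q * z pr.2 - p * z pr.1)) := by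
  set L := Finset.univ.filter (fun pr : Fin N × Fin N => pr.1 < pr.2) with hL
  let g : Fin N → Fin N → ℂ := fun i j =>
    if i < j then q * z j - p * z i else if j < i then -(q * z i - p * z j) else 0
  have hg : ∀ i j, g i j = -g j i := by
    intro i j
    rcases lt_trichotomy i j with h | h | h
    · simp [g, h, h.not_gt]
    · simp [g, h]
    · simp [g, h, h.not_gt]
  have hD : ∏ pr ∈ L, g pr.1 pr.2 = ∏ pr ∈ L, (q * z pr.2 - p * z pr.1) :=
    Finset.prod_congr rfl fun pr hpr => if_pos (Finset.mem_filter.mp hpr).2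
  have hD0 : ∏ pr ∈ L, (q * z pr.2 - p * z pr.1) ≠ 0 :=
    Finset.prod_ne_zero_iff.mpr fun pr hpr => hden _ _ (Finset.mem_filter.mp hpr).2.ne
  have hperm := prod_lt_comp_perm_eq_sign_mul_prod σ hg
  rw [← hL, hD] at hperm
  have hmul : (∏ pr ∈ L with σ pr.2 < σ pr.1, Sfac (p / q) (z (σ pr.1)) (z (σ pr.2))) *
      ∏ pr ∈ L, g (σ pr.1) (σ pr.2) = ∏ pr ∈ L, (q * z (σ pr.2) - p * z (σ pr.1)) := by
    rw [Finset.prod_filter, ← Finset.prod_mul_distrib]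
    refine Finset.prod_congr rfl fun pr hpr => ?_
    have hne : σ pr.1 ≠ σ pr.2 := σ.injective.ne (Finset.mem_filter.mp hpr).2.ne
    rcases hne.lt_or_gt with h | h
    · simp [g, h, h.not_gt]
    · have h0 := hden _ _ h.ne
      simp only [g, h, h.not_gt, if_true, if_false, Sfac_div hq]
      rw [neg_mul_neg, div_mul_cancel₀ _ h0]
  have hsign : ((Equiv.Perm.sign σ : ℤ) : ℂ) * ((Equiv.Perm.sign σ : ℤ) : ℂ) = 1 := by
    exact_mod_cast Int.units_coe_mul_self (Equiv.Perm.sign σ)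
  rw [hperm] at hmul
  rw [← Finset.filter_filter, Finset.prod_div_distrib, ← hmul, ← mul_assoc, mul_div_assoc',
    eq_div_iff hD0]
  linear_combination (-(∏ pr ∈ L with σ pr.2 < σ pr.1, Sfac (p / q) (z (σ pr.1)) (z (σ pr.2))) *
    ∏ pr ∈ L, (q * z pr.2 - p * z pr.1)) * hsign
end

section
/- Let 0 < τ < 1 and let n, m ≥ 1. Define θ(u) = 1 for u > 0 and θ(u) = 0 for u ≤ 0, and for x ∈ ℝⁿ, y ∈ ℝᵐ set H(x,y) = ∏_{j=1}^n ∏_{i=1}^m τ^{θ(x_j − y_i)}. Let f : ℝᵐ → ℝ be twice continuously differentiable with compact support contained in W_m^+ = {y ∈ ℝᵐ : y₁ ≤ ⋯ ≤ y_m}, and define F : ℝⁿ → ℝ by F(x) = ∫_{W_m^+} H(x,y) f(y) dy. Then for every j ∈ {1,…,n−1} and every x ∈ ℝⁿ with x_n < ⋯ < x_{j+2} < x_{j+1} = x_j < x_{j−1} < ⋯ < x₁, the one-sided derivatives D_j^+F(x) := lim_{h→0+} (F(x + h e_j) − F(x))/h and D_{j+1}^−F(x) := lim_{h→0+} (F(x)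 − F(x − h e_{j+1}))/h exist (these are the partial derivatives in the j-th and (j+1)-th coordinates taken from the interior of the chamber {x : x_{j+1} ≤ x_j}), and they satisfy the boundary condition τ · D_j^+F(x) − D_{j+1}^−F(x) = 0. -/
open MeasureTheory Set

/-- Heaviside function: `θ(u) = 1` for `u > 0` and `θ(u) = 0` for `u ≤ 0`. -/
noncomputable def heav (u : ℝ) : ℝ := if 0 < u then 1 else 0

/-- The duality function `H(x,y) = ∏_j ∏_i τ^{θ(x_j − y_i)}`. -/
noncomputable def Hdual (τ : ℝ) (n m : ℕ) (x : Fin n → ℝ) (y : Fin m → ℝ) : ℝ :=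
  ∏ j : Fin n, ∏ i : Fin m, τ ^ heav (x j - y i)

/-- `F(x) = ∫_{W_m^+} H(x,y) f(y) dy`, the integral over the Weyl chamber
`W_m^+ = {y : y₁ ≤ ⋯ ≤ y_m}`. -/
noncomputable def Fdual (τ : ℝ) (n m : ℕ) (f : (Fin m → ℝ) → ℝ) (x : Fin n → ℝ) : ℝ :=
  ∫ y in {y : Fin m → ℝ | Monotone y}, Hdual τ n m x y * f y

open Filter Topology

/-- Scaling and translating a single coordinate in a Lebesgue integral over `ℝᵐ`. -/
lemma integral_eq_abs_mul_integral_update {m : ℕ} (i : Fin m) (u : ℝ) {h : ℝ} (hh : h ≠ 0)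
    {g : (Fin m → ℝ) → ℝ} (hg : Measurable g) :
    ∫ y, g y = |h| * ∫ y, g (Function.update y i (u + h * y i)) := by
  have hdet : (Matrix.diagonal (Function.update (1 : Fin m → ℝ) i h)).det = h := by
    rw [Matrix.det_diagonal, Finset.prod_update_of_mem (Finset.mem_univ i)]
    simp
  have hmap := Real.smul_map_diagonal_volume_pi (D := Function.update (1 : Fin m → ℝ) i h)
    (by rwa [hdet])
  rw [hdet] at hmap
  rw [← integral_add_right_eq_self g (Pi.single i u)]
  conv_lhs => rw [← hmap]
  rw [integral_smul_measure, ENNReal.toReal_ofReal (abs_nonneg h), smul_eq_mul, integral_map]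
  · congr 2
    ext y
    congr 1
    ext k
    rcases eq_or_ne k i with rfl | hk
    · simp [Matrix.mulVec_diagonal, add_comm]
    · simp [Matrix.mulVec_diagonal, hk]
  · exact (LinearMap.continuous_of_finiteDimensional _).aemeasurable
  · exact (hg.comp (measurable_id.add_const _)).aestronglyMeasurable

/-- The indicator function of the half-open interval with endpoints `u` and `u + h`. -/
noncomputable def intervalBump (u h t : ℝ) : ℝ :=
  (Ico (min u (u + h)) (max u (u + h))).indicator 1 t

lemma measurable_intervalBump (u h : ℝ) : Measurable (intervalBump u h) :=
  measurable_one.indicator measurableSet_Ico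

lemma abs_intervalBump_le (u h t : ℝ) : |intervalBump u h t| ≤ 1 := by
  unfold intervalBump indicator
  split_ifs <;> simp

lemma intervalBump_rescaled {u h s : ℝ} (hh : h ≠ 0) (h0 : s ≠ 0) (h1 : s ≠ 1) :
    intervalBump u h (u + h * s) = (Ioo (0 : ℝ) 1).indicator 1 s := by
  unfold intervalBump
  have key : u + h * s ∈ Ico (min u (u + h)) (max u (u + h)) ↔ s ∈ Ioo (0 : ℝ) 1 := by
    rcases lt_or_gt_of_ne hh with hn | hp
    · rw [min_eq_right (by linarith), max_eq_left (by linarith)]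
      constructor
      · rintro ⟨ha, hb⟩
        refine ⟨by nlinarith, lt_of_le_of_ne (by nlinarith) h1⟩
      · rintro ⟨ha, hb⟩
        constructor <;> nlinarith
    · rw [min_eq_left (by linarith), max_eq_right (by linarith)]
      constructor
      · rintro ⟨ha, hb⟩
        refine ⟨lt_of_le_of_ne (by nlinarith) h0.symm, by nlinarith⟩
      · rintro ⟨ha, hb⟩
        constructor <;> nlinarith
  by_cases hs : s ∈ Ioo (0 : ℝ) 1
  · rw [indicator_of_mem hs, indicator_of_mem (key.2 hs)]; rfl
  · rw [indicator_of_notMem hs, indicator_of_notMem (mt key.1 hs)]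

lemma eventually_intervalBump_eq_zero {u t : ℝ} (ht : t ≠ u) :
    ∀ᶠ h in 𝓝 (0 : ℝ), intervalBump u h t = 0 := by
  have : ∀ᶠ h in 𝓝 (0 : ℝ), |h| < |t - u| :=
    (continuous_abs.tendsto' (0 : ℝ) 0 abs_zero).eventually_lt_const
      (abs_pos.2 (sub_ne_zero.2 ht))
  filter_upwards [this] with h hh
  refine indicator_of_notMem ?_ _
  rintro ⟨ha, hb⟩
  grind

/-- The integral `∫ ∏ᵢ w(yᵢ) f(y) dy`. -/
noncomputable def weightedIntegral {m : ℕ} (f : (Fin m → ℝ) → ℝ) (w : ℝ → ℝ) : ℝ :=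
  ∫ y, (∏ i, w (y i)) * f y

/-- The sum over `i` of the integrals of `∏_{k ≠ i} w(y_k) f(y)` over the hyperplane `yᵢ = u`,
each written as an integral over a slab of unit width. -/
noncomputable def hyperplaneSum {m : ℕ} (f : (Fin m → ℝ) → ℝ) (w : ℝ → ℝ) (u : ℝ) : ℝ :=
  ∑ i, ∫ y : Fin m → ℝ, (Ioo (0 : ℝ) 1).indicator 1 (y i) *
    (∏ k with k < i, w (y k)) * (∏ k with i < k, w (y k)) * f (Function.update y i u)

lemma integrable_mul_of_bounded {m : ℕ} {f g : (Fin m → ℝ) → ℝ} (hf : Continuous f)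
    (hfc : HasCompactSupport f) (hg : Measurable g) {C : ℝ} (hC : ∀ y, |g y| ≤ C) :
    Integrable fun y => g y * f y :=
  (hf.integrable_of_hasCompactSupport hfc).bdd_mul hg.aestronglyMeasurable (ae_of_all _ hC)

lemma abs_prod_le_pow {m : ℕ} (s : Finset (Fin m)) {g : Fin m → ℝ} {C : ℝ} (hC1 : 1 ≤ C)
    (hC : ∀ i, |g i| ≤ C) : |∏ i ∈ s, g i| ≤ C ^ m := by
  rw [Finset.abs_prod]
  calc ∏ i ∈ s, |g i| ≤ ∏ _i ∈ s, C :=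
        Finset.prod_le_prod (fun _ _ => abs_nonneg _) (fun i _ => hC i)
    _ = C ^ s.card := by simp
    _ ≤ C ^ m := pow_le_pow_right₀ hC1 (by simpa using s.card_le_univ)

lemma measurable_prod_apply {m : ℕ} (s : Finset (Fin m)) {w : ℝ → ℝ} (hw : Measurable w) :
    Measurable fun y : Fin m → ℝ => ∏ i ∈ s, w (y i) :=
  Finset.measurable_prod _ fun i _ => hw.comp (measurable_pi_apply i)

lemma ae_apply_ne {m : ℕ} (i : Fin m) (a : ℝ) : ∀ᵐ y : Fin m → ℝ, y i ≠ a := by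
  rw [ae_iff]
  simpa [volume_pi] using Measure.pi_hyperplane (fun _ : Fin m => (volume : Measure ℝ)) i a

lemma tendsto_integral_rescaled {m : ℕ} {f : (Fin m → ℝ) → ℝ} (hf : Continuous f)
    (hfc : HasCompactSupport f) {w : ℝ → ℝ} (hw : Measurable w) {C : ℝ} (hC : ∀ t, |w t| ≤ C)
    (u a : ℝ) (i : Fin m) :
    Tendsto (fun h => ∫ y : Fin m → ℝ, intervalBump u h (u + h * y i) *
        (∏ k with k < i, (w (y k) + a * intervalBump u h (y k))) * (∏ k with i < k, w (y k)) *
        f (Function.update y i (u + h * y i))) (𝓝[≠] 0)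
      (𝓝 (∫ y : Fin m → ℝ, (Ioo (0 : ℝ) 1).indicator 1 (y i) *
        (∏ k with k < i, w (y k)) * (∏ k with i < k, w (y k)) *
        f (Function.update y i u))) := by
  obtain ⟨M, hM⟩ := hfc.exists_bound_of_continuous hf
  obtain ⟨R, hR⟩ := hfc.isBounded.subset_closedBall 0
  have hC0 : 0 ≤ C := (abs_nonneg _).trans (hC 0)
  set K : ℝ := C + |a| + 1
  have hK1 : 1 ≤ K := by have := abs_nonneg a; linarith
  have hwK : ∀ t, |w t| ≤ K := fun t => (hC t).trans (by have := abs_nonneg a; linarith)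
  have hwaK : ∀ h t, |w t + a * intervalBump u h t| ≤ K := fun h t => by
    have h1 := abs_add_le (w t) (a * intervalBump u h t)
    rw [abs_mul] at h1
    have h2 := mul_le_mul_of_nonneg_left (abs_intervalBump_le u h t) (abs_nonneg a)
    have := hC t
    linarith
  have hupd : ∀ h : ℝ, Measurable fun y : Fin m → ℝ => Function.update y i (u + h * y i) :=
    fun h => (by fun_prop : Continuous
      fun y : Fin m → ℝ => Function.update y i (u + h * y i)).measurable
  have hsmall : ∀ᵐ y : Fin m → ℝ, y i ≠ 0 ∧ y i ≠ 1 ∧ ∀ k, y k ≠ u := by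
    filter_upwards [ae_apply_ne i 0, ae_apply_ne i 1, ae_all_iff.2 fun k => ae_apply_ne k u]
      with y h0 h1 hu using ⟨h0, h1, hu⟩
  refine tendsto_integral_filter_of_dominated_convergence
    ((Metric.closedBall (0 : Fin m → ℝ) (max R 1)).indicator fun _ => K ^ m * K ^ m * M)
    ?_ ?_ ?_ ?_
  · refine Eventually.of_forall fun h => Measurable.aestronglyMeasurable ?_
    refine ((Measurable.mul ?_ ?_).mul (measurable_prod_apply _ hw)).mul
      (hf.measurable.comp (hupd h))
    · exact (measurable_intervalBump u h).comp (by fun_prop)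
    · exact measurable_prod_apply _ (hw.add ((measurable_intervalBump u h).const_mul a))
  · filter_upwards [self_mem_nhdsWithin] with h hh
    filter_upwards [hsmall] with y hy
    rw [intervalBump_rescaled hh hy.1 hy.2.1]
    by_cases hball : y ∈ Metric.closedBall (0 : Fin m → ℝ) (max R 1)
    · rw [indicator_of_mem hball, Real.norm_eq_abs, abs_mul, abs_mul, abs_mul]
      have hi : |(Ioo (0 : ℝ) 1).indicator (1 : ℝ → ℝ) (y i)| ≤ 1 := by
        unfold indicator
        split_ifs <;> simp
      have hp := abs_prod_le_pow (Finset.univ.filter (· < i)) hK1 fun k => hwaK h (y k)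
      have hq := abs_prod_le_pow (Finset.univ.filter (i < ·)) hK1 fun k => hwK (y k)
      have hKm : 0 ≤ K ^ m := by positivity
      refine mul_le_mul (mul_le_mul ?_ hq (abs_nonneg _) hKm) (hM _) (abs_nonneg _)
        (by positivity)
      simpa using mul_le_mul hi hp (abs_nonneg _) zero_le_one
    · rw [indicator_of_notMem hball]
      rw [mem_closedBall_zero_iff, pi_norm_le_iff_of_nonneg (by positivity)] at hball
      push Not at hball
      obtain ⟨k, hk⟩ := hball
      rw [max_lt_iff, Real.norm_eq_abs] at hk
      rcases eq_or_ne k i with rfl | hki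
      · rw [indicator_of_notMem]
        · simp
        · rintro ⟨h0, h1⟩
          rw [abs_of_pos h0] at hk
          linarith [hk.2]
      · rw [image_eq_zero_of_notMem_tsupport (f := f)]
        · simp
        · intro hmem
          have := (norm_le_pi_norm _ k).trans (mem_closedBall_zero_iff.1 (hR hmem))
          rw [Function.update_of_ne hki, Real.norm_eq_abs] at this
          linarith [hk.1]
  · rw [integrable_indicator_iff measurableSet_closedBall]
    exact integrableOn_const (isCompact_closedBall _ _).measure_lt_top.ne
  · filter_upwards [hsmall] with y hy
    refine ((Tendsto.mul ?_ ?_).mul tendsto_const_nhds).mul ?_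
    · refine tendsto_const_nhds.congr' ?_
      filter_upwards [self_mem_nhdsWithin] with h hh
      exact (intervalBump_rescaled hh hy.1 hy.2.1).symm
    · refine tendsto_finsetProd _ fun k _ => tendsto_const_nhds.congr' ?_
      filter_upwards [(eventually_intervalBump_eq_zero (hy.2.2 k)).filter_mono
        nhdsWithin_le_nhds] with h hh
      rw [hh, mul_zero, add_zero]
    · have hc : Continuous fun h : ℝ => f (Function.update y i (u + h * y i)) :=
        hf.comp (by fun_prop)
      exact (hc.tendsto' 0 _ (by simp)).mono_left nhdsWithin_le_nhds

/-- First variation of `weightedIntegral` when the weight is modified on a short interval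
with endpoint `u`. -/
lemma tendsto_weightedIntegral_add_intervalBump {m : ℕ} {f : (Fin m → ℝ) → ℝ}
    (hf : Continuous f) (hfc : HasCompactSupport f) {w : ℝ → ℝ} (hw : Measurable w) {C : ℝ}
    (hC : ∀ t, |w t| ≤ C) (u a : ℝ) :
    Tendsto (fun h => |h|⁻¹ * (weightedIntegral f (fun t => w t + a * intervalBump u h t) -
      weightedIntegral f w)) (𝓝[≠] 0) (𝓝 (a * hyperplaneSum f w u)) := by
  have hlim := (tendsto_finsetSum Finset.univ fun i _ =>
    tendsto_integral_rescaled hf hfc hw hC u a i).const_mul a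
  refine hlim.congr' ?_
  filter_upwards [self_mem_nhdsWithin] with h (hh : h ≠ 0)
  have hC0 : 0 ≤ C := (abs_nonneg _).trans (hC 0)
  set K : ℝ := C + |a| + 1
  have hK1 : 1 ≤ K := by have := abs_nonneg a; linarith
  have hwK : ∀ t, |w t| ≤ K := fun t => (hC t).trans (by have := abs_nonneg a; linarith)
  have hb : ∀ t, |a * intervalBump u h t| ≤ |a| := fun t => by
    rw [abs_mul]
    exact mul_le_of_le_one_right (abs_nonneg a) (abs_intervalBump_le u h t)
  have hwaK : ∀ t, |w t + a * intervalBump u h t| ≤ K := fun t =>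
    (abs_add_le _ _).trans (by linarith [hC t, hb t])
  have hbm := (measurable_intervalBump u h).const_mul a
  have hterm_meas : ∀ i : Fin m, Measurable fun y : Fin m → ℝ => a * intervalBump u h (y i) *
      (∏ k with k < i, (w (y k) + a * intervalBump u h (y k))) * ∏ k with i < k, w (y k) :=
    fun i => ((hbm.comp (measurable_pi_apply i)).mul
      (measurable_prod_apply _ (hw.add hbm))).mul (measurable_prod_apply _ hw)
  have hterm : ∀ i : Fin m, Integrable fun y : Fin m → ℝ => (a * intervalBump u h (y i) *
      (∏ k with k < i, (w (y k) + a * intervalBump u h (y k))) * ∏ k with i < k, w (y k)) *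
      f y := fun i => by
    refine integrable_mul_of_bounded hf hfc (hterm_meas i) (C := |a| * K ^ m * K ^ m) fun y => ?_
    rw [abs_mul, abs_mul]
    exact mul_le_mul (mul_le_mul (hb _) (abs_prod_le_pow _ hK1 fun k => hwaK _) (abs_nonneg _)
      (abs_nonneg _)) (abs_prod_le_pow _ hK1 fun k => hwK _) (abs_nonneg _) (by positivity)
  have hbase : Integrable fun y : Fin m → ℝ => (∏ i, w (y i)) * f y :=
    integrable_mul_of_bounded hf hfc (measurable_prod_apply _ hw) fun y =>
      abs_prod_le_pow _ hK1 fun k => hwK _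
  unfold weightedIntegral
  have hexp : ∀ y : Fin m → ℝ, (∏ i, (w (y i) + a * intervalBump u h (y i))) * f y =
      (∏ i, w (y i)) * f y + ∑ i, (a * intervalBump u h (y i) *
        (∏ k with k < i, (w (y k) + a * intervalBump u h (y k))) * ∏ k with i < k, w (y k)) *
        f y := fun y => by
    rw [Finset.prod_add_ordered, add_mul, Finset.sum_mul]
  simp only [hexp]
  rw [integral_add hbase (integrable_finsetSum _ fun i _ => hterm i),
    integral_finsetSum _ fun i _ => hterm i, add_sub_cancel_left, Finset.mul_sum, Finset.mul_sum]
  refine Finset.sum_congr rfl fun i _ => ?_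
  have hscale := integral_eq_abs_mul_integral_update i u hh ((hterm_meas i).mul hf.measurable)
  simp only [Pi.mul_apply] at hscale
  rw [hscale,
    inv_mul_cancel_left₀ (abs_ne_zero.2 hh), ← integral_const_mul]
  congr 1
  ext y
  rw [Function.update_self]
  have hlt : ∏ k with k < i, (w (Function.update y i (u + h * y i) k) +
        a * intervalBump u h (Function.update y i (u + h * y i) k)) =
      ∏ k with k < i, (w (y k) + a * intervalBump u h (y k)) :=
    Finset.prod_congr rfl fun k hk => by
      rw [Function.update_of_ne (Finset.mem_filter.1 hk).2.ne]
  have hgt : ∏ k with i < k, w (Function.update y i (u + h * y i) k) =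
      ∏ k with i < k, w (y k) :=
    Finset.prod_congr rfl fun k hk => by
      rw [Function.update_of_ne (Finset.mem_filter.1 hk).2.ne']
  rw [hlt, hgt]
  ring

/-- The weight `∏ⱼ τ^{θ(xⱼ - t)}` that each dual variable contributes to `Hdual`. -/
noncomputable def dualWeight (τ : ℝ) {n : ℕ} (x : Fin n → ℝ) (t : ℝ) : ℝ :=
  ∏ k, τ ^ heav (x k - t)

lemma rpow_heav (τ a t : ℝ) : τ ^ heav (a - t) = if t < a then τ else 1 := by
  unfold heav
  simp only [sub_pos]
  split_ifs <;> simp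

lemma measurable_dualWeight (τ : ℝ) {n : ℕ} (x : Fin n → ℝ) : Measurable (dualWeight τ x) := by
  unfold dualWeight
  simp_rw [rpow_heav]
  exact Finset.measurable_prod _ fun k _ =>
    Measurable.ite measurableSet_Iio measurable_const measurable_const

lemma abs_dualWeight_le {τ : ℝ} (hτ : τ ∈ Ioo (0 : ℝ) 1) {n : ℕ} (x : Fin n → ℝ) (t : ℝ) :
    |dualWeight τ x t| ≤ 1 := by
  unfold dualWeight
  rw [Finset.abs_prod]
  refine Finset.prod_le_one (fun _ _ => abs_nonneg _) fun k _ => ?_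
  rw [rpow_heav]
  split_ifs
  · rw [abs_of_pos hτ.1]; exact hτ.2.le
  · simp

lemma Fdual_eq_weightedIntegral (τ : ℝ) {n m : ℕ} {f : (Fin m → ℝ) → ℝ}
    (hsupp : tsupport f ⊆ {y : Fin m → ℝ | Monotone y}) (x : Fin n → ℝ) :
    Fdual τ n m f x = weightedIntegral f (dualWeight τ x) := by
  unfold Fdual weightedIntegral dualWeight
  rw [setIntegral_eq_integral_of_forall_compl_eq_zero]
  · refine integral_congr_ae (ae_of_all _ fun y => ?_)
    simp only [Hdual]
    rw [Finset.prod_comm]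
  · intro y hy
    rw [image_eq_zero_of_notMem_tsupport fun hmem => hy (hsupp hmem), mul_zero]

/-- Moving one of two coinciding coordinates `x p = x q` by a small `h` changes the weight
by a multiple of the indicator of the swept interval. -/
lemma eventually_dualWeight_update (τ : ℝ) {n : ℕ} (x : Fin n → ℝ) {p q : Fin n} (hpq : p ≠ q)
    (hx : x p = x q) (hne : ∀ k, k ≠ p → k ≠ q → x k ≠ x p) :
    ∀ᶠ h in 𝓝 (0 : ℝ), ∀ t, dualWeight τ (Function.update x p (x p + h)) t =
      dualWeight τ x t +
        (if 0 < h then τ - 1 else (1 - τ) * τ) *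
          (∏ k ∈ (Finset.univ.erase p).erase q, τ ^ heav (x k - x p)) *
          intervalBump (x p) h t := by
  have hev : ∀ᶠ h in 𝓝 (0 : ℝ), ∀ k, k ≠ p → k ≠ q → |h| < |x k - x p| := by
    refine eventually_all.2 fun k => ?_
    by_cases hk : k ≠ p ∧ k ≠ q
    · filter_upwards [(continuous_abs.tendsto' (0 : ℝ) 0 abs_zero).eventually_lt_const
        (abs_pos.2 (sub_ne_zero.2 (hne k hk.1 hk.2)))] with h hh _ _ using hh
    · exact Eventually.of_forall fun h h1 h2 => (hk ⟨h1, h2⟩).elim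
  filter_upwards [hev] with h hh t
  have hsplit : ∀ z : Fin n → ℝ, dualWeight τ z t = τ ^ heav (z p - t) * (τ ^ heav (z q - t) *
      ∏ k ∈ (Finset.univ.erase p).erase q, τ ^ heav (z k - t)) := fun z => by
    rw [Finset.mul_prod_erase _ (fun k => τ ^ heav (z k - t))
        (Finset.mem_erase.2 ⟨hpq.symm, Finset.mem_univ q⟩),
      Finset.mul_prod_erase _ (fun k => τ ^ heav (z k - t)) (Finset.mem_univ p), dualWeight]
  have hrest : ∏ k ∈ (Finset.univ.erase p).erase q,
        τ ^ heav (Function.update x p (x p + h) k - t) =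
      ∏ k ∈ (Finset.univ.erase p).erase q, τ ^ heav (x k - t) :=
    Finset.prod_congr rfl fun k hk => by
      rw [Function.update_of_ne (Finset.mem_erase.1 (Finset.mem_erase.1 hk).2).1]
  rw [hsplit, hsplit x, hrest, Function.update_self, Function.update_of_ne hpq.symm, ← hx]
  unfold intervalBump
  by_cases ht : t ∈ Ico (min (x p) (x p + h)) (max (x p) (x p + h))
  · have hconst : ∏ k ∈ (Finset.univ.erase p).erase q, τ ^ heav (x k - t) =
        ∏ k ∈ (Finset.univ.erase p).erase q, τ ^ heav (x k - x p) :=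
      Finset.prod_congr rfl fun k hk => by
        have hk' := hh k (Finset.mem_erase.1 (Finset.mem_erase.1 hk).2).1 (Finset.mem_erase.1 hk).1
        obtain ⟨ha, hb⟩ := ht
        rw [rpow_heav, rpow_heav]
        have : t < x k ↔ x p < x k := by grind
        simp only [this]
    rw [indicator_of_mem ht, hconst, rpow_heav, rpow_heav, Pi.one_apply]
    obtain ⟨ha, hb⟩ := ht
    rcases lt_or_ge 0 h with hp | hn
    · rw [min_eq_left (by linarith)] at ha
      rw [max_eq_right (by linarith)] at hb
      rw [if_pos hb, if_neg (not_lt.2 ha), if_pos hp]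
      ring
    · rw [min_eq_right (by linarith)] at ha
      rw [max_eq_left (by linarith)] at hb
      rw [if_neg (not_lt.2 ha), if_pos hb, if_neg (not_lt.2 hn)]
      ring
  · rw [indicator_of_notMem ht, mul_zero, add_zero, rpow_heav, rpow_heav]
    have : t < x p + h ↔ t < x p := by
      rw [mem_Ico] at ht
      grind
    simp only [this]

/-- Boundary condition for the dual variables: at `x_{j+1} = x_j` (the other coordinates
strictly decreasing), the one-sided partial derivatives (from the interior of the chamber
`x_{j+1} ≤ x_j`) exist and satisfy `τ D_j^+ F − D_{j+1}^− F = 0`. -/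
theorem Fdual_boundary (τ : ℝ) (hτ : τ ∈ Set.Ioo (0 : ℝ) 1) (n m : ℕ)
    (hn : 1 ≤ n) (hm : 1 ≤ m)
    (f : (Fin m → ℝ) → ℝ) (hf : ContDiff ℝ 2 f) (hfc : HasCompactSupport f)
    (hsupp : tsupport f ⊆ {y : Fin m → ℝ | Monotone y})
    (j : Fin n) (hj : (j : ℕ) + 1 < n)
    (x : Fin n → ℝ) (hxeq : x j = x ⟨(j : ℕ) + 1, hj⟩)
    (hord : ∀ i k : Fin n, i < k → ¬(i = j ∧ k = ⟨(j : ℕ) + 1, hj⟩) → x k < x i) :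
    ∃ d d' : ℝ,
      HasDerivWithinAt (fun h : ℝ => Fdual τ n m f (Function.update x j (x j + h)))
        d (Set.Ici 0) 0 ∧
      HasDerivWithinAt
        (fun h : ℝ => Fdual τ n m f
          (Function.update x ⟨(j : ℕ) + 1, hj⟩ (x ⟨(j : ℕ) + 1, hj⟩ + h)))
        d' (Set.Iic 0) 0 ∧
      τ * d - d' = 0 := by
  set q : Fin n := ⟨(j : ℕ) + 1, hj⟩ with hq
  have hjq : j ≠ q := fun h => by simpa [hq] using congrArg Fin.val h
  have hne : ∀ k, k ≠ j → k ≠ q → x k ≠ x j := fun k hkj hkq => by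
    rcases lt_or_gt_of_ne hkj with h | h
    · exact (hord k j h fun h' => hkj h'.1).ne'
    · exact (hord j k h fun h' => hkq h'.2).ne
  set c : ℝ := ∏ k ∈ (Finset.univ.erase j).erase q, τ ^ heav (x k - x j) with hc
  set Λ : ℝ := hyperplaneSum f (dualWeight τ x) (x j)
  have hlim := tendsto_weightedIntegral_add_intervalBump hf.continuous hfc
    (measurable_dualWeight τ x) (abs_dualWeight_le hτ x) (x j)
  refine ⟨(τ - 1) * c * Λ, -((1 - τ) * τ * c * Λ), ?_, ?_, by ring⟩
  · have hupd := eventually_dualWeight_update τ x hjq hxeq hne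
    rw [← hc] at hupd
    rw [hasDerivWithinAt_iff_tendsto_slope, Ici_sdiff_left]
    refine ((hlim ((τ - 1) * c)).mono_left
      (nhdsWithin_mono _ fun h (hh : 0 < h) => hh.ne')).congr' ?_
    filter_upwards [self_mem_nhdsWithin, hupd.filter_mono nhdsWithin_le_nhds]
      with h (hpos : 0 < h) hw
    simp only [slope_def_field, sub_zero, add_zero, Function.update_eq_self,
      Fdual_eq_weightedIntegral τ hsupp, funext hw, if_pos hpos, abs_of_pos hpos]
    field_simp
  · have hc' : ∏ k ∈ (Finset.univ.erase q).erase j, τ ^ heav (x k - x j) = c := by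
      rw [hc, Finset.erase_right_comm]
    have hupd := eventually_dualWeight_update τ x hjq.symm hxeq.symm fun k hkq hkj =>
      hxeq ▸ hne k hkj hkq
    rw [← hxeq, hc'] at hupd
    rw [hasDerivWithinAt_iff_tendsto_slope, Iic_sdiff_right, ← hxeq]
    refine ((hlim ((1 - τ) * τ * c)).neg.mono_left
      (nhdsWithin_mono _ fun h (hh : h < 0) => hh.ne)).congr' ?_
    filter_upwards [self_mem_nhdsWithin, hupd.filter_mono nhdsWithin_le_nhds]
      with h (hneg : h < 0) hw
    have h0 : Function.update x q (x j) = x := by rw [hxeq, Function.update_eq_self]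
    simp only [slope_def_field, sub_zero, add_zero, h0,
      Fdual_eq_weightedIntegral τ hsupp, funext hw, if_neg hneg.not_gt, abs_of_neg hneg]
    field_simp
end
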